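/- There is an absolute constant C > 0 such that for every integer n ≥ 7 and every integer r ≥ 1, the series Σ_{s=r}^{∞} ‖P_s‖₂/P_s(1) converges and Σ_{s=r}^{∞} ‖P_s‖₂/P_s(1) ≤ C · r · ‖P_r‖₂/P_r(1). -/

import Mathlib

open Polynomial Set

/-- `IsJacobi α s P` says that `P` is the Jacobi polynomial `P_s^{(α,α)}`:
the unique real polynomial of degree `s` orthogonal to all lower-degree
monomials with respect to the weight `(1 - t²)^α` on `(-1,1)`, normalized by
`P(1) = Γ(s+α+1)/(Γ(α+1)·s!)`. -/
def IsJacobi (α : ℝ) (s : ℕ) (P : Polynomial ℝ) : Prop :=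
  P.degree = (s : ℕ) ∧
  (∀ j < s, (∫ t in (-1 : ℝ)..1, P.eval t * t ^ j * (1 - t ^ 2) ^ α) = 0) ∧
  P.eval 1 = Real.Gamma ((s : ℝ) + α + 1) / (Real.Gamma (α + 1) * (Nat.factorial s : ℝ))

/-- The weight function `w(t) = (1-t²)^{(n-3)/2}`. -/
noncomputable def jWeight (n : ℕ) (t : ℝ) : ℝ := (1 - t ^ 2) ^ (((n : ℝ) - 3) / 2)

/-- `‖P‖₂ = (∫_{-1}^1 P(t)² (1-t²)^{(n-3)/2} dt)^{1/2}`. -/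
noncomputable def jNorm (n : ℕ) (P : Polynomial ℝ) : ℝ :=
  Real.sqrt (∫ t in (-1 : ℝ)..1, (P.eval t) ^ 2 * jWeight n t)

/-- The first-order operator `f ↦ (1 - X²) f' + c X f`. -/
noncomputable def ladder (c : ℝ) (f : ℝ[X]) : ℝ[X] :=
  (1 - X ^ 2) * derivative f + C c * X * f

/-- A positive definite even functional satisfying the integration by parts rule of the
weight `(1 - t²)^α`. -/
structure IsUltraspherical (α : ℝ) (L : ℝ[X] →ₗ[ℝ] ℝ) : Prop where
  pos : ∀ f, f ≠ 0 → 0 < L (f * f)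
  parts : ∀ f, L ((1 - X ^ 2) * derivative f) = (2 * α + 2) * L (X * f)
  even : ∀ f, L (f.comp (-X)) = L f

/-- A sequence of polynomials of degrees `0, 1, 2, …`, each orthogonal to all polynomials of
smaller degree. -/
structure IsOrthogonalSeq (L : ℝ[X] →ₗ[ℝ] ℝ) (P : ℕ → ℝ[X]) : Prop where
  degree_eq : ∀ s : ℕ, (P s).degree = (s : ℕ)
  orthogonal : ∀ (s : ℕ) (r : ℝ[X]), r.degree < (s : ℕ) → L (P s * r) = 0

lemma coeff_comp_neg_X (f : ℝ[X]) (k : ℕ) : (f.comp (-X)).coeff k = (-1) ^ k * f.coeff k := by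
  rw [show (-X : ℝ[X]) = C (-1) * X by simp, comp_C_mul_X_coeff, mul_comm]

lemma coeff_ladder_succ (c : ℝ) (f : ℝ[X]) (k : ℕ) :
    (ladder c f).coeff (k + 1) = (k + 2) * f.coeff (k + 2) + (c - k) * f.coeff k := by
  have h : ladder c f = derivative f - X * (X * derivative f) + C c * (X * f) := by
    unfold ladder; ring
  rw [h]
  cases k with
  | zero =>
    simp only [coeff_add, coeff_sub, coeff_derivative, coeff_C_mul, coeff_X_mul, zero_add,
      coeff_X_mul_zero]
    push_cast
    ring
  | succ k =>
    simp only [coeff_add, coeff_sub, coeff_derivative, coeff_C_mul, coeff_X_mul]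
    push_cast
    ring

lemma eval_one_ladder (c : ℝ) (f : ℝ[X]) : (ladder c f).eval 1 = c * f.eval 1 := by
  simp [ladder]

lemma ladder_eq_add (c d : ℝ) (f : ℝ[X]) : ladder c f = ladder d f + (c - d) • (X * f) := by
  simp only [ladder, smul_eq_C_mul, C_sub]
  ring

lemma degree_ladder_lt {f : ℝ[X]} {m : ℕ} (c : ℝ) (hf : f.degree < (m : ℕ)) :
    (ladder c f).degree < ((m + 1 : ℕ) : WithBot ℕ) := by
  rw [degree_lt_iff_coeff_zero] at hf ⊢
  intro k hk
  obtain ⟨k, rfl⟩ := Nat.exists_eq_add_of_le' (Nat.one_le_of_lt hk)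
  rw [coeff_ladder_succ, hf _ (by omega), hf _ (by omega)]
  ring

lemma degree_ladder_self_lt {f : ℝ[X]} {m : ℕ} (hf : f.degree < ((m + 1 : ℕ) : WithBot ℕ)) :
    (ladder m f).degree < ((m + 1 : ℕ) : WithBot ℕ) := by
  rw [degree_lt_iff_coeff_zero] at hf ⊢
  intro k hk
  obtain ⟨k, rfl⟩ := Nat.exists_eq_add_of_le' (Nat.one_le_of_lt hk)
  rw [coeff_ladder_succ, hf (k + 2) (by omega)]
  rcases (show m ≤ k by omega).eq_or_lt with rfl | h
  · ring
  · rw [hf k (by omega)]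
    ring

namespace IsUltraspherical

variable {α : ℝ} {L : ℝ[X] →ₗ[ℝ] ℝ} {P : ℕ → ℝ[X]}

lemma ladder_adjoint (hL : IsUltraspherical α L) (c : ℝ) (f g : ℝ[X]) :
    L (ladder c f * g) = -L (f * ladder (-(c + 2 * α + 2)) g) := by
  have h := hL.parts (f * g)
  have e : ladder c f * g + f * ladder (-(c + 2 * α + 2)) g =
      (1 - X ^ 2) * derivative (f * g) - (2 * α + 2) • (X * (f * g)) := by
    simp only [ladder, derivative_mul, smul_eq_C_mul, C_neg, C_add, C_mul]
    ring
  have e' := congrArg L e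
  rw [map_add, map_sub, map_smul, smul_eq_mul, h] at e'
  linarith

lemma comp_neg_X (hL : IsUltraspherical α L) (hP : IsOrthogonalSeq L P) (s : ℕ) :
    (P s).comp (-X) = C ((-1) ^ s) * P s := by
  set Q := (P s).comp (-X) - C ((-1) ^ s) * P s with hQ
  have hcoeff := (degree_lt_iff_coeff_zero (P s) (s + 1)).1
    (by rw [hP.degree_eq]; exact_mod_cast Nat.lt_succ_self s)
  have hdeg : Q.degree < (s : ℕ) := by
    rw [degree_lt_iff_coeff_zero]
    intro k hk
    rw [hQ, coeff_sub, coeff_comp_neg_X, coeff_C_mul]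
    rcases hk.eq_or_lt with rfl | h
    · ring
    · rw [hcoeff k h]
      ring
  have h₁ : L ((P s).comp (-X) * Q) = 0 := by
    rw [← hL.even, mul_comp, comp_assoc]
    simpa using hP.orthogonal s (Q.comp (-X)) (by rwa [degree_comp_neg_X])
  have h₂ : L (C ((-1) ^ s) * P s * Q) = 0 := by
    rw [mul_assoc, ← smul_eq_C_mul, map_smul, hP.orthogonal s _ hdeg, smul_zero]
  by_contra hne
  have hpos := hL.pos Q (by rwa [hQ, sub_ne_zero])
  have hzero : L (Q * Q) = 0 := by
    nth_rewrite 1 [hQ]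
    rw [sub_mul, map_sub, h₁, h₂, sub_zero]
  exact hpos.ne' hzero

lemma map_X_mul_self (hL : IsUltraspherical α L) (hP : IsOrthogonalSeq L P) (s : ℕ) :
    L (X * (P s * P s)) = 0 := by
  have h := hL.even (X * (P s * P s))
  have e : (X * (P s * P s)).comp (-X) = -(X * (P s * P s)) := by
    rw [mul_comp, mul_comp, hL.comp_neg_X hP, X_comp]
    have : C ((-1 : ℝ) ^ s) * C ((-1 : ℝ) ^ s) = 1 := by
      rw [← C_mul, ← mul_pow]
      simp
    linear_combination (-X * (P s * P s)) * this
  rw [e, map_neg] at h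
  linarith

lemma map_ladder_mul_self (hL : IsUltraspherical α L) (hP : IsOrthogonalSeq L P) (c : ℝ)
    (s : ℕ) : L (ladder c (P s) * P s) = 0 := by
  have h := hL.ladder_adjoint c (P s) (P s)
  rw [ladder_eq_add (-(c + 2 * α + 2)) c, mul_add, map_add, mul_smul_comm, map_smul,
    mul_left_comm, hL.map_X_mul_self hP, mul_comm (P s) (ladder c (P s)), smul_zero] at h
  linarith

lemma eq_zero_of_orthogonal (hL : IsUltraspherical α L) (hP : IsOrthogonalSeq L P) {m : ℕ}
    {Q : ℝ[X]} (hdeg : Q.degree < (m : ℕ)) (hQ : ∀ i < m, L (Q * P i) = 0) : Q = 0 := by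
  have key : ∀ k ≤ m, ∀ r : ℝ[X], r.degree < (k : ℕ) → L (Q * r) = 0 := by
    intro k
    induction k with
    | zero =>
      intro _ r hr
      rw [degree_lt_iff_coeff_zero] at hr
      have : r = 0 := by
        ext i
        simpa using hr i (Nat.zero_le i)
      simp [this]
    | succ k ih =>
      intro hk r hr
      have hlead : (P k).coeff k ≠ 0 := coeff_ne_zero_of_eq_degree (hP.degree_eq k)
      have hcoeff := (degree_lt_iff_coeff_zero (P k) (k + 1)).1
        (by rw [hP.degree_eq]; exact_mod_cast Nat.lt_succ_self k)
      rw [degree_lt_iff_coeff_zero] at hr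
      have hlow := ih (by omega) (r - (r.coeff k / (P k).coeff k) • P k) (by
        rw [degree_lt_iff_coeff_zero]
        intro j hj
        rw [coeff_sub, coeff_smul, smul_eq_mul]
        rcases hj.eq_or_lt with rfl | h
        · field_simp
          ring
        · rw [hr j h, hcoeff j h]
          ring)
      rw [mul_sub, map_sub, mul_smul_comm, map_smul, hQ k (by omega), smul_zero, sub_zero]
        at hlow
      exact hlow
  by_contra hne
  exact (hL.pos Q hne).ne' (key m le_rfl Q hdeg)

lemma eq_smul_of_orthogonal (hL : IsUltraspherical α L) (hP : IsOrthogonalSeq L P) {m j : ℕ}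
    (hj : j < m) {Q : ℝ[X]} (hdeg : Q.degree < (m : ℕ))
    (hQ : ∀ i < m, i ≠ j → L (Q * P i) = 0) : ∃ c : ℝ, Q = c • P j := by
  have hne : P j ≠ 0 := by
    intro h
    simpa [h] using hP.degree_eq j
  refine ⟨L (Q * P j) / L (P j * P j), sub_eq_zero.1 (hL.eq_zero_of_orthogonal hP (m := m) ?_ ?_)⟩
  · refine (degree_sub_le _ _).trans_lt (max_lt hdeg ((degree_smul_le _ _).trans_lt ?_))
    rw [hP.degree_eq]
    exact_mod_cast hj
  · intro i hi
    rw [sub_mul, map_sub, smul_mul_assoc, map_smul, smul_eq_mul]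
    rcases lt_trichotomy i j with h | rfl | h
    · rw [hQ i hi h.ne, hP.orthogonal j (P i) (by rw [hP.degree_eq]; exact_mod_cast h)]
      simp
    · rw [div_mul_cancel₀ _ (hL.pos _ hne).ne', sub_self]
    · rw [hQ i hi h.ne', mul_comm (P j) (P i),
        hP.orthogonal i (P j) (by rw [hP.degree_eq]; exact_mod_cast h)]
      simp

lemma ladder_raising (hL : IsUltraspherical α L) (hP : IsOrthogonalSeq L P) (s : ℕ) :
    ∃ c : ℝ, ladder (-(s + 2 * α + 1)) (P s) = c • P (s + 1) := by
  refine hL.eq_smul_of_orthogonal hP (m := s + 2) (by omega)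
    (degree_ladder_lt _ (by rw [hP.degree_eq]; exact_mod_cast Nat.lt_succ_self s)) ?_
  intro i hi hne
  rcases (show i ≤ s by omega).eq_or_lt with rfl | h
  · exact hL.map_ladder_mul_self hP _ _
  · obtain ⟨m, rfl⟩ := Nat.exists_eq_add_of_le' (Nat.one_le_of_lt h)
    rw [hL.ladder_adjoint, hP.orthogonal, neg_zero]
    have e : -(-(((m + 1 : ℕ) : ℝ) + 2 * α + 1) + 2 * α + 2) = m := by
      push_cast
      ring
    rw [e]
    exact degree_ladder_self_lt (by rw [hP.degree_eq]; exact_mod_cast h)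

lemma ladder_lowering (hL : IsUltraspherical α L) (hP : IsOrthogonalSeq L P) (s : ℕ) :
    ∃ c : ℝ, ladder (s + 1 : ℕ) (P (s + 1)) = c • P s := by
  refine hL.eq_smul_of_orthogonal hP (m := s + 2) (by omega)
    (degree_ladder_self_lt (by rw [hP.degree_eq]; exact_mod_cast Nat.lt_succ_self (s + 1))) ?_
  intro i hi hne
  rcases (show i ≤ s + 1 by omega).eq_or_lt with rfl | h
  · exact hL.map_ladder_mul_self hP _ _
  · rw [hL.ladder_adjoint, hP.orthogonal, neg_zero]
    exact degree_ladder_lt _ (by rw [hP.degree_eq]; exact_mod_cast (show i < s by omega))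

/-- The ratio of consecutive squared norms of orthogonal polynomials normalized at `1`. -/
lemma normSq_succ (hL : IsUltraspherical α L) (hP : IsOrthogonalSeq L P)
    (h1 : ∀ s, (P s).eval 1 ≠ 0) (s : ℕ) :
    (s + 2 * α + 1) * (2 * s + 2 * α + 3) * (L (P (s + 1) * P (s + 1)) / (P (s + 1)).eval 1 ^ 2)
      = (2 * s + 2 * α + 1) * (s + 1) * (L (P s * P s) / (P s).eval 1 ^ 2) := by
  obtain ⟨c, hc⟩ := hL.ladder_raising hP s
  obtain ⟨d, hd⟩ := hL.ladder_lowering hP s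
  have hc1 := congrArg (eval 1) hc
  have hd1 := congrArg (eval 1) hd
  rw [eval_one_ladder, eval_smul, smul_eq_mul] at hc1 hd1
  have hmix : L (P (s + 1) * ladder s (P s)) = 0 := hP.orthogonal _ _
    (degree_ladder_self_lt (by rw [hP.degree_eq]; exact_mod_cast Nat.lt_succ_self s))
  have hc2 := congrArg (fun f => L (P (s + 1) * f)) hc
  have hd2 := congrArg (fun f => L (f * P s)) hd
  simp only [hL.ladder_adjoint] at hd2
  beta_reduce at hc2
  rw [ladder_eq_add _ (s : ℝ) (P s)] at hc2 hd2
  simp only [mul_add, smul_mul_assoc, mul_smul_comm, map_add,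
    map_smul, hmix, smul_eq_mul] at hc2 hd2
  push_cast at hd1 hd2
  have ha := h1 s
  have hb := h1 (s + 1)
  have hc3 : c = -(s + 2 * α + 1) * (P s).eval 1 / (P (s + 1)).eval 1 := by
    rw [eq_div_iff hb]
    linarith
  have hd3 : d = (s + 1) * (P (s + 1)).eval 1 / (P s).eval 1 := by
    rw [eq_div_iff ha]
    linarith
  rw [hc3] at hc2
  rw [hd3] at hd2
  field_simp at hc2 hd2 ⊢
  linear_combination (P s).eval 1 * (2 * s + 2 * α + 3) * hc2 +
    (P (s + 1)).eval 1 * (2 * s + 2 * α + 1) * hd2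

end IsUltraspherical

lemma continuous_weight {α : ℝ} (hα : 0 ≤ α) : Continuous fun t : ℝ => (1 - t ^ 2) ^ α :=
  (by fun_prop : Continuous fun t : ℝ => 1 - t ^ 2).rpow_const fun _ => Or.inr hα

lemma intervalIntegrable_eval_mul_weight {α : ℝ} (hα : 0 ≤ α) (f : ℝ[X]) :
    IntervalIntegrable (fun t : ℝ => f.eval t * (1 - t ^ 2) ^ α) MeasureTheory.volume (-1) 1 :=
  (f.continuous.mul (continuous_weight hα)).intervalIntegrable _ _

/-- Integration of polynomials over `[-1, 1]` against the weight `(1 - t²)^α`. -/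
noncomputable def ultrasphericalIntegral (α : ℝ) (hα : 0 ≤ α) : ℝ[X] →ₗ[ℝ] ℝ where
  toFun f := ∫ t in (-1 : ℝ)..1, f.eval t * (1 - t ^ 2) ^ α
  map_add' f g := by
    simp only [eval_add, add_mul]
    exact intervalIntegral.integral_add (intervalIntegrable_eval_mul_weight hα f)
      (intervalIntegrable_eval_mul_weight hα g)
  map_smul' c f := by
    simp only [eval_smul, smul_eq_mul, mul_assoc, RingHom.id_apply]
    exact intervalIntegral.integral_const_mul _ _

lemma ultrasphericalIntegral_apply {α : ℝ} (hα : 0 ≤ α) (f : ℝ[X]) :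
    ultrasphericalIntegral α hα f = ∫ t in (-1 : ℝ)..1, f.eval t * (1 - t ^ 2) ^ α := rfl

lemma isUltraspherical_integral {α : ℝ} (hα : 0 ≤ α) :
    IsUltraspherical α (ultrasphericalIntegral α hα) where
  pos f hf := by
    rw [ultrasphericalIntegral_apply]
    obtain ⟨x, hx, hfx⟩ : ∃ x ∈ Ioo (-1 : ℝ) 1, f.eval x ≠ 0 := by
      by_contra! h
      exact hf (eq_zero_of_infinite_isRoot f
        ((Ioo_infinite (by norm_num : (-1 : ℝ) < 1)).mono fun x hx => h x hx))
    have hw : ∀ t ∈ Icc (-1 : ℝ) 1, 0 ≤ 1 - t ^ 2 := fun t ht => by nlinarith [ht.1, ht.2]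
    refine intervalIntegral.integral_pos (by norm_num)
      ((f * f).continuous.mul (continuous_weight hα)).continuousOn (fun t ht => ?_)
      ⟨x, Ioo_subset_Icc_self hx, ?_⟩
    · rw [eval_mul]
      exact mul_nonneg (mul_self_nonneg _) (Real.rpow_nonneg (hw t (Ioc_subset_Icc_self ht)) _)
    · rw [eval_mul]
      exact mul_pos (mul_self_pos.2 hfx) (Real.rpow_pos_of_pos (by nlinarith [hx.1, hx.2]) _)
  parts f := by
    have hderiv : ∀ t ∈ uIcc (-1 : ℝ) 1, HasDerivAt (fun t => f.eval t * (1 - t ^ 2) ^ (α + 1))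
        (((1 - X ^ 2) * derivative f - (2 * α + 2) • (X * f)).eval t * (1 - t ^ 2) ^ α) t := by
      intro t ht
      rw [uIcc_of_le (by norm_num)] at ht
      have hbase : HasDerivAt (fun t : ℝ => 1 - t ^ 2) (-(2 * t)) t := by
        simpa using (hasDerivAt_pow 2 t).const_sub 1
      refine ((f.hasDerivAt t).mul
        (hbase.rpow_const (p := α + 1) (Or.inr (by linarith)))).congr_deriv ?_
      rw [Real.rpow_add_one' (by nlinarith [ht.1, ht.2]) (by linarith), add_sub_cancel_right]
      simp only [eval_sub, eval_mul, eval_smul, eval_pow, eval_X, eval_one, smul_eq_mul]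
      ring
    have h := intervalIntegral.integral_eq_sub_of_hasDerivAt hderiv
      (intervalIntegrable_eval_mul_weight hα _)
    rw [← ultrasphericalIntegral_apply hα, map_sub, map_smul, smul_eq_mul] at h
    norm_num [Real.zero_rpow (by linarith : α + 1 ≠ 0)] at h
    linarith
  even f := by
    simp only [ultrasphericalIntegral_apply]
    have h := intervalIntegral.integral_comp_neg (a := -1) (b := 1)
      (fun t : ℝ => f.eval t * (1 - t ^ 2) ^ α)
    simpa using h

lemma isOrthogonalSeq_of_isJacobi {α : ℝ} (hα : 0 ≤ α) {P : ℕ → ℝ[X]}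
    (hP : ∀ s, IsJacobi α s (P s)) : IsOrthogonalSeq (ultrasphericalIntegral α hα) P where
  degree_eq s := (hP s).1
  orthogonal s r hr := by
    have hX : ∀ j < s, ultrasphericalIntegral α hα (P s * X ^ j) = 0 := by
      intro j hj
      simpa [ultrasphericalIntegral_apply] using (hP s).2.1 j hj
    rw [r.as_sum_range_C_mul_X_pow, Finset.mul_sum, map_sum]
    refine Finset.sum_eq_zero fun j _ => ?_
    rw [mul_left_comm, ← smul_eq_C_mul, map_smul]
    rcases lt_or_ge j s with h | h
    · rw [hX j h, smul_zero]
    · rw [(degree_lt_iff_coeff_zero r s).1 hr j h, zero_smul]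

lemma IsJacobi.eval_one_pos {α : ℝ} (hα : 0 ≤ α) {s : ℕ} {P : ℝ[X]} (hP : IsJacobi α s P) :
    0 < P.eval 1 := by
  rw [hP.2.2]
  have h₁ := Real.Gamma_pos_of_pos (by positivity : 0 < (s : ℝ) + α + 1)
  have h₂ := Real.Gamma_pos_of_pos (by positivity : 0 < α + 1)
  positivity

/-- A nonnegative sequence decaying at least as fast as the ratio `(s + 2) / (s + 4)` has
tails bounded by telescoping. -/
lemma tail_bound_of_ratio {a : ℕ → ℝ} (ha : ∀ s, 0 ≤ a s)
    (hratio : ∀ s : ℕ, a (s + 1) * (s + 4) ≤ a s * (s + 2)) (r : ℕ) :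
    Summable (fun i => a (r + i)) ∧ ∑' i, a (r + i) ≤ (r + 3) * a r := by
  have hsum : ∀ k, ∑ i ∈ Finset.range k, a (r + i) ≤
      (r + 3) * a r - ((r + k : ℕ) + 3) * a (r + k) := by
    intro k
    induction k with
    | zero => simp
    | succ k ih =>
      rw [Finset.sum_range_succ]
      have h := hratio (r + k)
      rw [← add_assoc]
      push_cast at ih h ⊢
      linarith
  have hle : ∀ k, ∑ i ∈ Finset.range k, a (r + i) ≤ (r + 3) * a r := fun k =>
    (hsum k).trans (sub_le_self _ (mul_nonneg (by positivity) (ha _)))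
  exact ⟨summable_of_sum_range_le (fun i => ha _) hle,
    Real.tsum_le_of_sum_range_le (fun i => ha _) hle⟩

lemma ratio_le_of_sq_ratio {α x a b : ℝ} (hα : 2 ≤ α) (hx : 0 ≤ x) (ha : 0 ≤ a)
    (h : (x + 2 * α + 1) * (2 * x + 2 * α + 3) * b ^ 2 =
      (2 * x + 2 * α + 1) * (x + 1) * a ^ 2) :
    b * (x + 4) ≤ a * (x + 2) := by
  have h₁ : (x + 5) * b ^ 2 ≤ (x + 1) * a ^ 2 := by
    have hk : (0 : ℝ) < 2 * x + 2 * α + 3 := by positivity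
    refine le_of_mul_le_mul_left ?_ hk
    calc (2 * x + 2 * α + 3) * ((x + 5) * b ^ 2)
        = (x + 5) * (2 * x + 2 * α + 3) * b ^ 2 := by ring
      _ ≤ (x + 2 * α + 1) * (2 * x + 2 * α + 3) * b ^ 2 := by
          have h₀ : x + 5 ≤ x + 2 * α + 1 := by linarith
          gcongr ?_ * _ * _
      _ = (2 * x + 2 * α + 1) * ((x + 1) * a ^ 2) := by rw [h]; ring
      _ ≤ (2 * x + 2 * α + 3) * ((x + 1) * a ^ 2) := by
          gcongr
          linarith
  refine (abs_le_of_sq_le_sq' ?_ (by positivity)).2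
  refine le_of_mul_le_mul_left ?_ (by positivity : 0 < x + 5)
  calc (x + 5) * (b * (x + 4)) ^ 2 = (x + 4) ^ 2 * ((x + 5) * b ^ 2) := by ring
    _ ≤ (x + 4) ^ 2 * ((x + 1) * a ^ 2) := mul_le_mul_of_nonneg_left h₁ (sq_nonneg _)
    _ ≤ (x + 5) * (a * (x + 2)) ^ 2 := by nlinarith [sq_nonneg a]

/-- Lemma 2.3: there is an absolute constant `C > 0` such that for `n ≥ 7`
and `r ≥ 1`, the series `Σ_{s≥r} ‖P_s‖₂/P_s(1)` converges and is at most
`C · r · ‖P_r‖₂/P_r(1)`. -/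
theorem tail_sum_bound :
    ∃ C : ℝ, 0 < C ∧
      ∀ n : ℕ, 7 ≤ n →
      ∀ P : ℕ → Polynomial ℝ, (∀ s, IsJacobi (((n : ℝ) - 3) / 2) s (P s)) →
      ∀ r : ℕ, 1 ≤ r →
      Summable (fun i : ℕ => jNorm n (P (r + i)) / (P (r + i)).eval 1) ∧
      (∑' i : ℕ, jNorm n (P (r + i)) / (P (r + i)).eval 1) ≤
        C * r * (jNorm n (P r) / (P r).eval 1) := by
  refine ⟨4, by norm_num, fun n hn P hP r hr => ?_⟩
  set α : ℝ := ((n : ℝ) - 3) / 2 with hαdef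
  have hn' : (7 : ℝ) ≤ n := by exact_mod_cast hn
  have hα2 : 2 ≤ α := by
    rw [hαdef]
    linarith
  have hα : 0 ≤ α := by linarith
  have hpos : ∀ s, 0 < (P s).eval 1 := fun s => (hP s).eval_one_pos hα
  have hL := isUltraspherical_integral hα
  set L := ultrasphericalIntegral α hα
  have hnorm : ∀ s, jNorm n (P s) = √(L (P s * P s)) := by
    intro s
    simp only [jNorm, jWeight, L, ultrasphericalIntegral_apply, eval_mul, sq (eval _ _)]
    rfl
  have hnonneg : ∀ s, 0 ≤ L (P s * P s) := fun s =>
    (hL.pos _ fun h => (hpos s).ne' (by simp [h])).le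
  have hsq : ∀ s, (jNorm n (P s) / (P s).eval 1) ^ 2 = L (P s * P s) / (P s).eval 1 ^ 2 := by
    intro s
    rw [div_pow, hnorm, Real.sq_sqrt (hnonneg s)]
  have ha : ∀ s, 0 ≤ jNorm n (P s) / (P s).eval 1 := fun s =>
    div_nonneg (Real.sqrt_nonneg _) (hpos s).le
  have hratio : ∀ s : ℕ, jNorm n (P (s + 1)) / (P (s + 1)).eval 1 * (s + 4) ≤
      jNorm n (P s) / (P s).eval 1 * (s + 2) := by
    intro s
    have h := hL.normSq_succ (isOrthogonalSeq_of_isJacobi hα hP) (fun s => (hpos s).ne') s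
    rw [← hsq, ← hsq] at h
    exact ratio_le_of_sq_ratio hα2 s.cast_nonneg (ha s) h
  obtain ⟨hs, hle⟩ := tail_bound_of_ratio ha hratio r
  refine ⟨hs, hle.trans (mul_le_mul_of_nonneg_right ?_ (ha r))⟩
  have hr' : (1 : ℝ) ≤ r := by exact_mod_cast hr
  linarith
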